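/- arXiv:2503.23915 — 2 statements merged into one kernel-verified Lean document; each statement's English description precedes it below -/
import Mathlib

section
/- Let m = 2, β = [1, i] ∈ ℂ^{1×2}, J = [[0,1],[1,0]], H(x) ≡ β*β on [0,b], and T = [[1,i],[i,1]]. For z ∈ ℂ with Im z ≠ 0, define W(x,z) := T^{−1} · M(x,z), where M(x,z) is the 2×2 matrix whose first row is β and whose second row is 2i(Log z − Log(z−x)) β + β J, with Log the principal branch of the complex logarithm. Then for each such z, the function x ↦ W(x,z) is differentiable on [0,b], satisfies W_x(x,z) = i(z−x)^{−1} J H(x) W(x,z) on [0,b], and W(0,z) = I₂. Moreover, T J T* = 2J and T^{−1} = (1/2)[[1,−i],[−i,1]]. -/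
open Matrix

attribute [local instance] Matrix.normedAddCommGroup Matrix.normedSpace

/-- `β = [1, i]`. -/
noncomputable def βex : Matrix (Fin 1) (Fin 2) ℂ := !![1, Complex.I]

/-- `J = [[0,1],[1,0]]`. -/
noncomputable def Jex : Matrix (Fin 2) (Fin 2) ℂ := !![0, 1; 1, 0]

/-- `T = [[1,i],[i,1]]`, the matrix with rows `β` and `βJ`. -/
noncomputable def Tex : Matrix (Fin 2) (Fin 2) ℂ := !![1, Complex.I; Complex.I, 1]

/-- The explicit fundamental solution (5.4):
`W(x,z) = T⁻¹ ⬝ M(x,z)`, where the first row of `M(x,z)` is `β` and its second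
row is `2i(Log z − Log(z−x)) β + β J`. -/
noncomputable def Wex (x : ℝ) (z : ℂ) : Matrix (Fin 2) (Fin 2) ℂ :=
  Tex⁻¹ *
    !![1, Complex.I;
       2 * Complex.I * (Complex.log z - Complex.log (z - (x : ℂ))) + Complex.I,
       1 - 2 * (Complex.log z - Complex.log (z - (x : ℂ)))]

theorem Tex_inv : Tex⁻¹ = ((1 : ℂ) / 2) • !![1, -Complex.I; -Complex.I, 1] := by
  refine Matrix.inv_eq_right_inv ?_
  ext i j
  fin_cases i <;> fin_cases j <;> simp [Tex, Matrix.mul_apply, Fin.sum_univ_two] <;> ring_nf <;>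
    simp <;> norm_num

theorem Tex_mul_Jex_mul_conjTranspose : Tex * Jex * Texᴴ = (2 : ℂ) • Jex := by
  ext i j
  fin_cases i <;> fin_cases j <;>
    simp [Tex, Jex, Matrix.mul_apply, Fin.sum_univ_two] <;> norm_num

/-- `W` written out entrywise, with `L = Log z − Log (z − x)`. -/
theorem Wex_eq (x : ℝ) (z : ℂ) :
    Wex x z =
      !![1 + (Complex.log z - Complex.log (z - (x : ℂ))),
         Complex.I * (Complex.log z - Complex.log (z - (x : ℂ)));
         Complex.I * (Complex.log z - Complex.log (z - (x : ℂ))),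
         1 - (Complex.log z - Complex.log (z - (x : ℂ)))] := by
  rw [Wex, Tex_inv]
  generalize Complex.log z - Complex.log (z - (x : ℂ)) = L
  ext i j
  fin_cases i <;> fin_cases j <;> simp [Matrix.mul_apply, Fin.sum_univ_two] <;> ring_nf <;>
    simp <;> ring

/-- `J H W = J H`, since `β W = β`. -/
theorem Jex_mul_Wex (x : ℝ) (z : ℂ) :
    Jex * (βexᴴ * βex) * Wex x z = !![-Complex.I, 1; 1, Complex.I] := by
  have hJH : Jex * (βexᴴ * βex) = !![-Complex.I, 1; 1, Complex.I] := by
    ext i j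
    fin_cases i <;> fin_cases j <;>
      simp [Jex, βex, Matrix.mul_apply, Fin.sum_univ_two]
  rw [hJH, Wex_eq]
  generalize Complex.log z - Complex.log (z - (x : ℂ)) = L
  ext i j
  fin_cases i <;> fin_cases j <;> simp [Matrix.mul_apply, Fin.sum_univ_two] <;> ring_nf <;>
    simp

theorem hasDerivAt_log_sub_log_sub_ofReal {z : ℂ} (hz : z.im ≠ 0) (x : ℝ) :
    HasDerivAt (fun t : ℝ => Complex.log z - Complex.log (z - (t : ℂ))) (z - (x : ℂ))⁻¹ x := by
  have hsub : HasDerivAt (fun t : ℝ => z - (t : ℂ)) (-1) x :=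
    (Complex.ofRealCLM.hasDerivAt (x := x)).const_sub z
  have hslit : z - (x : ℂ) ∈ Complex.slitPlane := Or.inr (by simpa using hz)
  simpa [neg_div] using (hsub.clog_real hslit).const_sub (Complex.log z)

/-- the explicit matrix function (5.4) is the fundamental solution
of the non-isospectral canonical system with constant rank-one Hamiltonian
`H = β*β`, `β = [1, i]`; moreover `T J T* = 2J` and
`T⁻¹ = (1/2)[[1,−i],[−i,1]]`. -/
theorem stmt_18 (b : ℝ) :
    (∀ z : ℂ, z.im ≠ 0 →
      (∀ x ∈ Set.Icc (0 : ℝ) b,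
        HasDerivAt (fun t : ℝ => Wex t z)
          ((Complex.I * (z - (x : ℂ))⁻¹) • (Jex * (βexᴴ * βex) * Wex x z)) x) ∧
      Wex 0 z = 1) ∧
    Tex * Jex * Texᴴ = (2 : ℂ) • Jex ∧
    Tex⁻¹ = ((1 : ℂ) / 2) • !![1, -Complex.I; -Complex.I, 1] := by
  refine ⟨fun z hz => ⟨fun x _ => ?_, ?_⟩, Tex_mul_Jex_mul_conjTranspose, Tex_inv⟩
  · have hL := hasDerivAt_log_sub_log_sub_ofReal hz x
    rw [Jex_mul_Wex]
    simp only [Wex_eq]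
    refine hasDerivAt_pi.2 fun i => hasDerivAt_pi.2 fun j => ?_
    fin_cases i <;> fin_cases j
    · refine (hL.const_add 1).congr_deriv ?_
      simp only [Matrix.smul_apply, smul_eq_mul]
      simp
      linear_combination (z - (x : ℂ))⁻¹ * Complex.I_mul_I
    · refine (hL.const_mul Complex.I).congr_deriv ?_
      simp
    · refine (hL.const_mul Complex.I).congr_deriv ?_
      simp
    · refine (hL.const_sub 1).congr_deriv ?_
      simp
      linear_combination -(z - (x : ℂ))⁻¹ * Complex.I_mul_I
  · rw [Wex_eq]
    simp [Matrix.one_fin_two]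
end

section
/- Let m = 2, β = [1, i] ∈ ℂ^{1×2}, J = [[0,1],[1,0]], H(x) ≡ β*β on [0,b], and for Im z ≠ 0 let W(x,z) be the fundamental solution of w_x = i(z−x)^{−1} J H w with W(0,z) = I₂. Then for every x, s with 0 < s < x ≤ b, the one-sided limits W_±(x,s) := lim_{η→0+} W(x, s ± iη) exist and satisfy the jump relation W_+(x,s) = W_−(x,s) R(s)², where R(s) = I₂ + π J β*β; equivalently, since (J β*β)² = 0, one has W_+(x,s) = W_−(x,s)(I₂ + 2π J β*β). -/
open Matrix

attribute [local instance] Matrix.normedAddCommGroup Matrix.normedSpace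

open Filter Topology

/-- The canonical coefficient matrix of the example, written out. -/
lemma jex_mul_βex_gram : Jex * βexᴴ * βex = !![-Complex.I, 1; 1, Complex.I] := by
  ext i j
  fin_cases i <;> fin_cases j <;>
    simp [Jex, βex, Matrix.mul_apply, Matrix.conjTranspose_apply, Fin.sum_univ_two,
      -Matrix.cons_mul]

lemma jex_mul_βex_gram_sq : (Jex * βexᴴ * βex) * (Jex * βexᴴ * βex) = 0 := by
  rw [jex_mul_βex_gram]
  ext i j
  fin_cases i <;> fin_cases j <;> simp [Matrix.mul_apply]

/-- The primitive in `x` of `i / (z - x)` that vanishes at `x = 0`. -/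
noncomputable def logPrimitive (x : ℝ) (z : ℂ) : ℂ :=
  Complex.I * (Complex.log z - Complex.log (z - x))

lemma hasDerivAt_logPrimitive {z : ℂ} (hz : z.im ≠ 0) (x : ℝ) :
    HasDerivAt (fun t : ℝ => logPrimitive t z) (Complex.I * (z - (x : ℂ))⁻¹) x := by
  have h1 : HasDerivAt (fun t : ℝ => z - (t : ℂ)) (-1) x :=
    (Complex.ofRealCLM.hasDerivAt (x := x)).const_sub z
  have h2 := h1.clog_real (Or.inr (by simpa using hz))
  exact ((h2.const_sub (Complex.log z)).const_mul Complex.I).congr_deriv (by ring)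

/-- A column `(a, d)` of a solution is determined by its value at `0`. -/
lemma eq_of_hasDerivAt_column {b : ℝ} {a d c f : ℝ → ℂ} (hc0 : c 0 = 0)
    (hc : ∀ x ∈ Set.Icc (0 : ℝ) b, HasDerivAt c (f x) x)
    (ha : ∀ x ∈ Set.Icc (0 : ℝ) b, HasDerivAt a (f x * (-Complex.I * a x + d x)) x)
    (hd : ∀ x ∈ Set.Icc (0 : ℝ) b, HasDerivAt d (f x * (a x + Complex.I * d x)) x)
    {x : ℝ} (hx : x ∈ Set.Icc (0 : ℝ) b) :
    a x = a 0 + c x * (-Complex.I * a 0 + d 0) ∧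
      d x = d 0 + c x * (a 0 + Complex.I * d 0) := by
  have hI := Complex.I_mul_I
  have hconst : ∀ g : ℝ → ℂ, (∀ y ∈ Set.Icc (0 : ℝ) b, HasDerivAt g 0 y) → g x = g 0 :=
    fun g hg => constant_of_has_deriv_right_zero
      (fun y hy => (hg y hy).continuousAt.continuousWithinAt)
      (fun y hy => (hg y (Set.Ico_subset_Icc_self hy)).hasDerivWithinAt) x hx
  have hu : -Complex.I * a x + d x = -Complex.I * a 0 + d 0 := by
    refine hconst (fun y => -Complex.I * a y + d y) fun y hy => ?_
    refine (((ha y hy).const_mul (-Complex.I)).add (hd y hy)).congr_deriv ?_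
    linear_combination f y * a y * hI
  have h1 : a x - c x * (-Complex.I * a x + d x) = a 0 - c 0 * (-Complex.I * a 0 + d 0) := by
    refine hconst (fun y => a y - c y * (-Complex.I * a y + d y)) fun y hy => ?_
    refine ((ha y hy).sub ((hc y hy).mul
      (((ha y hy).const_mul (-Complex.I)).add (hd y hy)))).congr_deriv ?_
    simp only [Pi.add_apply]
    linear_combination -c y * f y * a y * hI
  have h2 : d x - c x * (a x + Complex.I * d x) = d 0 - c 0 * (a 0 + Complex.I * d 0) := by
    refine hconst (fun y => d y - c y * (a y + Complex.I * d y)) fun y hy => ?_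
    refine ((hd y hy).sub ((hc y hy).mul
      ((ha y hy).add ((hd y hy).const_mul Complex.I)))).congr_deriv ?_
    simp only [Pi.add_apply]
    linear_combination -c y * f y * d y * hI
  rw [hc0] at h1 h2
  constructor
  · linear_combination h1 + c x * hu
  · linear_combination h2 + c x * Complex.I * hu + c x * (a x - a 0) * hI

/-- The solution of the canonical system in closed form. -/
lemma solution_eq {b : ℝ} {z : ℂ} (hz : z.im ≠ 0) {V : ℝ → Matrix (Fin 2) (Fin 2) ℂ}
    (h0 : V 0 = 1)
    (hV : ∀ x ∈ Set.Icc (0 : ℝ) b, HasDerivAt V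
        ((Complex.I * (z - (x : ℂ))⁻¹) • (Jex * (βexᴴ * βex) * V x)) x)
    {x : ℝ} (hx : x ∈ Set.Icc (0 : ℝ) b) :
    V x = 1 + logPrimitive x z • (Jex * βexᴴ * βex) := by
  have hentry : ∀ i j, ∀ y ∈ Set.Icc (0 : ℝ) b, HasDerivAt (fun t => V t i j)
      (((Complex.I * (z - (y : ℂ))⁻¹) • (Jex * βexᴴ * βex * V y)) i j) y := by
    intro i j y hy
    have h := hV y hy
    rw [← Matrix.mul_assoc] at h
    exact hasDerivAt_pi.1 (hasDerivAt_pi.1 h i) j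
  rw [jex_mul_βex_gram] at hentry ⊢
  have hcol := fun j => eq_of_hasDerivAt_column (b := b)
    (a := fun t => V t 0 j) (d := fun t => V t 1 j)
    (by simp [logPrimitive]) (fun y _ => hasDerivAt_logPrimitive hz y)
    (fun y hy => by simpa [Matrix.mul_apply, Fin.sum_univ_two, -Matrix.cons_mul] using hentry 0 j y hy)
    (fun y hy => by simpa [Matrix.mul_apply, Fin.sum_univ_two, -Matrix.cons_mul] using hentry 1 j y hy) hx
  ext i j
  fin_cases i
  · have h := (hcol j).1
    fin_cases j <;> simpa [h0] using h
  · have h := (hcol j).2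
    fin_cases j <;> simpa [h0] using h

/-- If `z` tends to `s > 0` and `log (z - x)` converges, then so
does the primitive `logPrimitive x z`. -/
lemma tendsto_logPrimitive {α : Type*} {l : Filter α} {z : α → ℂ} {s x : ℝ} {m : ℂ}
    (hs : 0 < s) (hz : Tendsto z l (𝓝 s))
    (hlog : Tendsto (fun t => Complex.log (z t - x)) l (𝓝 m)) :
    Tendsto (fun t => logPrimitive x (z t)) l (𝓝 (Complex.I * (Complex.log s - m))) :=
  ((hz.clog (Complex.ofReal_mem_slitPlane.2 hs)).sub hlog).const_mul _

/-- the jump relation (5.5−): for the fundamental solution of the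
non-isospectral canonical system with `H ≡ β*β`, `β = [1,i]`, the boundary
values `W_±(x,s)` exist for `0 < s < x ≤ b` and satisfy
`W₊(x,s) = W₋(x,s) R(s)²` with `R(s) = I₂ + π J β*β`; equivalently, since
`(J β*β)² = 0`, `W₊(x,s) = W₋(x,s)(I₂ + 2π J β*β)`. -/
theorem stmt_19 (b : ℝ) (W : ℝ → ℂ → Matrix (Fin 2) (Fin 2) ℂ)
    (hW : ∀ z : ℂ, z.im ≠ 0 → W 0 z = 1 ∧
      ∀ x ∈ Set.Icc (0 : ℝ) b, HasDerivAt (fun t : ℝ => W t z)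
        ((Complex.I * (z - (x : ℂ))⁻¹) • (Jex * (βexᴴ * βex) * W x z)) x) :
    ∀ x s : ℝ, 0 < s → s < x → x ≤ b →
      ∃ Wp Wm : Matrix (Fin 2) (Fin 2) ℂ,
        Filter.Tendsto (fun η : ℝ => W x ((s : ℂ) + (η : ℂ) * Complex.I))
          (nhdsWithin 0 (Set.Ioi 0)) (nhds Wp) ∧
        Filter.Tendsto (fun η : ℝ => W x ((s : ℂ) - (η : ℂ) * Complex.I))
          (nhdsWithin 0 (Set.Ioi 0)) (nhds Wm) ∧
        Wp = Wm * ((1 + (Real.pi : ℂ) • (Jex * βexᴴ * βex)) *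
          (1 + (Real.pi : ℂ) • (Jex * βexᴴ * βex))) ∧
        (Jex * βexᴴ * βex) * (Jex * βexᴴ * βex) = 0 ∧
        Wp = Wm * (1 + ((2 * Real.pi : ℝ) : ℂ) • (Jex * βexᴴ * βex)) := by
  intro x s hs hsx hxb
  have hx : x ∈ Set.Icc (0 : ℝ) b := ⟨(hs.trans hsx).le, hxb⟩
  have hneg : ((s : ℂ) - x).re < 0 := by simpa using hsx
  have him : ((s : ℂ) - x).im = 0 := by simp
  have hpos : ∀ᶠ η : ℝ in 𝓝[>] 0, 0 < η := self_mem_nhdsWithin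
  have hzp : Tendsto (fun η : ℝ => (s : ℂ) + (η : ℂ) * Complex.I) (𝓝[>] 0) (𝓝 s) :=
    tendsto_nhdsWithin_of_tendsto_nhds <| Continuous.tendsto' (by fun_prop) _ _ (by simp)
  have hzm : Tendsto (fun η : ℝ => (s : ℂ) - (η : ℂ) * Complex.I) (𝓝[>] 0) (𝓝 s) :=
    tendsto_nhdsWithin_of_tendsto_nhds <| Continuous.tendsto' (by fun_prop) _ _ (by simp)
  have hcp := tendsto_logPrimitive hs hzp <|
    (Complex.tendsto_log_nhdsWithin_im_nonneg_of_re_neg_of_im_zero hneg him).comp <|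
      tendsto_nhdsWithin_iff.2 ⟨hzp.sub_const (x : ℂ),
        hpos.mono fun η hη => by simpa using hη.le⟩
  have hcm := tendsto_logPrimitive hs hzm <|
    (Complex.tendsto_log_nhdsWithin_im_neg_of_re_neg_of_im_zero hneg him).comp <|
      tendsto_nhdsWithin_iff.2 ⟨hzm.sub_const (x : ℂ),
        hpos.mono fun η hη => by simpa using hη⟩
  have hlim : ∀ {z : ℝ → ℂ} {c : ℂ}, (∀ᶠ η in 𝓝[>] 0, (z η).im ≠ 0) →
      Tendsto (fun η => logPrimitive x (z η)) (𝓝[>] 0) (𝓝 c) →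
      Tendsto (fun η => W x (z η)) (𝓝[>] 0) (𝓝 (1 + c • (Jex * βexᴴ * βex))) :=
    fun hz hc => ((hc.smul_const _).const_add 1).congr' <| hz.mono fun η hη =>
      (solution_eq hη (hW _ hη).1 (hW _ hη).2 hx).symm
  have hN := jex_mul_βex_gram_sq
  refine ⟨_, _, hlim (hpos.mono fun η hη => by simpa using hη.ne') hcp,
    hlim (hpos.mono fun η hη => by simpa using hη.ne') hcm, ?_, hN, ?_⟩ <;>
  · generalize Jex * βexᴴ * βex = N at hN
    simp only [mul_add, add_mul, Matrix.smul_mul, Matrix.mul_smul, hN, mul_one, one_mul,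
      smul_zero, add_zero]
    rw [add_assoc]
    simp only [add_assoc, ← add_smul]
    congr 2
    push_cast
    linear_combination (-2 * Real.pi : ℂ) * Complex.I_mul_I
end
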